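/- arXiv:2501.11357 — 5 statements merged into one kernel-verified Lean document; each statement's English description precedes it below -/
import Mathlib

section
/- Let g: U × X → X be continuous and a uniform μ-contraction in the state variable, i.e. ‖g(u,x) − g(u,z)‖ ≤ μ‖x − z‖ for all u ∈ U and x, z ∈ X, where 0 < μ < 1. Then the operator Ψ: C(𝒰, X) → C(𝒰, X) defined by Ψ(H)(u) = g(u[1], H(θ⁻¹(u))) is well defined (i.e. Ψ(H) is continuous for every continuous H) and is a μ-contraction with respect to the uniform metric: ρ(Ψ(F), Ψ(H)) ≤ μ·ρ(F, H) for all F, H ∈ C(𝒰, X). -/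
open Filter Topology

noncomputable section

/-- `ℝ^n` with the ℓ¹ norm `‖v‖ = ∑ᵢ |vᵢ|`. -/
abbrev Vec (n : ℕ) : Type := PiLp 1 (fun _ : Fin n => ℝ)

/-- If `g : U × X → X` is continuous and a uniform `μ`-contraction in the
state variable (`0 < μ < 1`), then the operator `Ψ(H)(u) = g(u[1], H(θ⁻¹ u))` on the space
of continuous maps `𝒰 → X` (where `𝒰 = U^ℤ` has the product topology) is well defined, i.e.
`Ψ(H)` is continuous for continuous `H`, and is a `μ`-contraction for the uniform metric
`ρ(H, F) = ⨆ u, ‖H u - F u‖`. -/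
theorem stmt0 (Nin Nr : ℕ) (U : Set (Vec Nin)) (X : Set (Vec Nr))
    (hU : IsCompact U) (hX : IsCompact X)
    (g : U → X → X) (hg : Continuous fun p : U × X => g p.1 p.2)
    (μ : ℝ) (hμ0 : 0 < μ) (hμ1 : μ < 1)
    (hcontr : ∀ (u : U) (x z : X),
      ‖(g u x : Vec Nr) - (g u z : Vec Nr)‖ ≤ μ * ‖(x : Vec Nr) - (z : Vec Nr)‖)
    -- the right shift `θ⁻¹` on `𝒰 = U^ℤ`
    (θinv : (ℤ → U) → (ℤ → U)) (hθinv : ∀ u n, θinv u n = u (n - 1))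
    -- the operator `Ψ`
    (Ψ : ((ℤ → U) → X) → ((ℤ → U) → X))
    (hΨ : ∀ H u, Ψ H u = g (u 1) (H (θinv u))) :
    (∀ H : (ℤ → U) → X, Continuous H → Continuous (Ψ H)) ∧
    (∀ F H : (ℤ → U) → X, Continuous F → Continuous H →
      (⨆ u : ℤ → U, ‖(Ψ F u : Vec Nr) - (Ψ H u : Vec Nr)‖) ≤
        μ * ⨆ u : ℤ → U, ‖(F u : Vec Nr) - (H u : Vec Nr)‖) := by
  have hθ : Continuous θinv := by
    refine continuous_pi fun n => ?_
    simp only [hθinv]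
    exact continuous_apply (n - 1)
  refine ⟨fun H hH => ?_, fun F H hF hH => ?_⟩
  · have h : Ψ H = fun u => g (u 1) (H (θinv u)) := funext (hΨ H)
    rw [h]
    exact hg.comp ((continuous_apply (1 : ℤ)).prodMk (hH.comp hθ))
  · haveI : CompactSpace U := isCompact_iff_compactSpace.mp hU
    have hcont : Continuous fun u : ℤ → U => ‖(F u : Vec Nr) - (H u : Vec Nr)‖ :=
      ((continuous_subtype_val.comp hF).sub (continuous_subtype_val.comp hH)).norm
    have hbdd : BddAbove (Set.range fun u : ℤ → U => ‖(F u : Vec Nr) - (H u : Vec Nr)‖) :=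
      (isCompact_range hcont).bddAbove
    refine Real.iSup_le (fun u => ?_)
      (mul_nonneg hμ0.le (Real.iSup_nonneg fun u => norm_nonneg _))
    rw [hΨ, hΨ]
    exact (hcontr _ _ _).trans
      (mul_le_mul_of_nonneg_left (le_ciSup hbdd (θinv u)) hμ0.le)
end
end

section
/- Let g: U × X → X be continuous and a uniform μ-contraction in the state variable, i.e. ‖g(u,x) − g(u,z)‖ ≤ μ‖x − z‖ for all u ∈ U and x, z ∈ X, where 0 < μ < 1. Then there exists a unique continuous map H ∈ C(𝒰, X) satisfying H(u) = g(u[1], H(θ⁻¹(u))) for all u ∈ 𝒰; moreover, for every initial choice H₀ ∈ C(𝒰, X), the iterates defined by H_{n+1}(u) = g(u[1], H_n(θ⁻¹(u))) converge to H with respect to the uniform metric ρ as n → ∞. -/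
open Filter Topology

noncomputable section

/-- If `g : U × X → X` is continuous and a uniform `μ`-contraction in the
state variable (`0 < μ < 1`), then there is a unique continuous `H : 𝒰 → X` with
`H(u) = g(u[1], H(θ⁻¹ u))` for all `u ∈ 𝒰 = U^ℤ`, and for every continuous initial choice
`H₀`, the iterates `H_{n+1}(u) = g(u[1], H_n(θ⁻¹ u))` converge to `H` in the uniform
metric `ρ(F, H) = ⨆ u, ‖F u - H u‖`. -/
theorem stmt1 (Nin Nr : ℕ) (U : Set (Vec Nin)) (X : Set (Vec Nr))
    (hU : IsCompact U) (hX : IsCompact X) (hXne : X.Nonempty)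
    (g : U → X → X) (hg : Continuous fun p : U × X => g p.1 p.2)
    (μ : ℝ) (hμ0 : 0 < μ) (hμ1 : μ < 1)
    (hcontr : ∀ (u : U) (x z : X),
      ‖(g u x : Vec Nr) - (g u z : Vec Nr)‖ ≤ μ * ‖(x : Vec Nr) - (z : Vec Nr)‖)
    -- the right shift `θ⁻¹` on `𝒰 = U^ℤ`
    (θinv : (ℤ → U) → (ℤ → U)) (hθinv : ∀ u n, θinv u n = u (n - 1)) :
    ∃ H : (ℤ → U) → X, Continuous H ∧ (∀ u, H u = g (u 1) (H (θinv u))) ∧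
      (∀ H' : (ℤ → U) → X, Continuous H' → (∀ u, H' u = g (u 1) (H' (θinv u))) → H' = H) ∧
      (∀ Hseq : ℕ → (ℤ → U) → X, Continuous (Hseq 0) →
        (∀ n u, Hseq (n + 1) u = g (u 1) (Hseq n (θinv u))) →
        Tendsto (fun n => ⨆ u : ℤ → U, ‖(Hseq n u : Vec Nr) - (H u : Vec Nr)‖)
          atTop (𝓝 0)) := by
  haveI : CompactSpace U := isCompact_iff_compactSpace.mp hU
  haveI : CompactSpace X := isCompact_iff_compactSpace.mp hX
  haveI : Nonempty X := hXne.to_subtype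
  have hθ : Continuous θinv := by
    refine continuous_pi fun n => ?_
    simp only [hθinv]
    exact continuous_apply _
  have hstep : ∀ F : (ℤ → U) → X, Continuous F →
      Continuous fun u : ℤ → U => g (u 1) (F (θinv u)) := fun F hF =>
    hg.comp ((continuous_apply (1 : ℤ)).prodMk (hF.comp hθ))
  let T : C(ℤ → U, X) → C(ℤ → U, X) := fun F => ⟨_, hstep F F.continuous⟩
  have hdist : ∀ x z : X, dist x z = ‖(x : Vec Nr) - (z : Vec Nr)‖ := fun x z => by
    rw [Subtype.dist_eq, dist_eq_norm]
  have hT : ContractingWith ⟨μ, hμ0.le⟩ T := by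
    refine ⟨by exact_mod_cast hμ1, LipschitzWith.of_dist_le_mul fun F G => ?_⟩
    refine (ContinuousMap.dist_le (mul_nonneg hμ0.le dist_nonneg)).2 fun u => ?_
    have h1 := hcontr (u 1) (F (θinv u)) (G (θinv u))
    rw [← hdist, ← hdist] at h1
    exact h1.trans (mul_le_mul_of_nonneg_left (ContinuousMap.dist_apply_le_dist _) hμ0.le)
  haveI : Nonempty C(ℤ → U, X) := ⟨ContinuousMap.const _ (Classical.arbitrary X)⟩
  let H : C(ℤ → U, X) := ContractingWith.fixedPoint T hT
  have hH : T H = H := hT.fixedPoint_isFixedPt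
  refine ⟨H, H.continuous, fun u => (DFunLike.congr_fun hH u).symm, ?_, ?_⟩
  · intro H' hc hfix
    have h2 : Function.IsFixedPt T ⟨H', hc⟩ := by
      ext1 u
      exact (hfix u).symm
    exact congrArg (fun F : C(ℤ → U, X) => (F : (ℤ → U) → X)) (hT.fixedPoint_unique h2)
  · intro Hseq h0 hs
    have hit : ∀ n, ∀ u, Hseq n u = (T^[n] ⟨Hseq 0, h0⟩) u := by
      intro n
      induction n with
      | zero => intro u; rfl
      | succ k ih =>
        intro u
        rw [Function.iterate_succ_apply', hs, ih]
        rfl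
    have hlim := tendsto_iff_dist_tendsto_zero.1 (hT.tendsto_iterate_fixedPoint ⟨Hseq 0, h0⟩)
    refine squeeze_zero (fun n => Real.iSup_nonneg fun u => norm_nonneg _) (fun n => ?_) hlim
    refine Real.iSup_le (fun u => ?_) dist_nonneg
    rw [← hdist, hit]
    exact ContinuousMap.dist_apply_le_dist u
end
end

section
/- Let g: U × X → X be continuous and a uniform μ-contraction in the state variable, i.e. ‖g(u,x) − g(u,z)‖ ≤ μ‖x − z‖ for all u ∈ U and x, z ∈ X, where 0 < μ < 1, and let H ∈ C(𝒰, X) be the unique continuous map satisfying H(u) = g(u[1], H(θ⁻¹(u))) for all u ∈ 𝒰. Then the echo state property holds: for every u ∈ 𝒰, if x: ℤ → X is any entire solution for u, then x[n] = H(θ^{n−1}(u)) for all n ∈ ℤ; in particular every u ∈ 𝒰 has exactly one entire solution. -/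
open Filter Topology

noncomputable section

/-- The cocycle `Φ` of the reservoir system: `Φ 0 u x = x` and
`Φ (n+1) u x = g (u[n+1]) (Φ n u x)`. -/
def coc {Nin Nr : ℕ} {U : Set (Vec Nin)} {X : Set (Vec Nr)}
    (g : U → X → X) : ℕ → (ℤ → U) → X → X
  | 0, _, x => x
  | n + 1, u, x => g (u ((n : ℤ) + 1)) (coc g n u x)

/-- `x : ℤ → X` is an entire solution for the input sequence `u`:
`x[n] = Φ(n − m, θ^m u, x[m])` for all integers `m ≤ n`, where `(θ^m u)[k] = u[k + m]`. -/
def entire {Nin Nr : ℕ} {U : Set (Vec Nin)} {X : Set (Vec Nr)}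
    (g : U → X → X) (u : ℤ → U) (x : ℤ → X) : Prop :=
  ∀ m n : ℤ, m ≤ n → x n = coc g (n - m).toNat (fun k => u (k + m)) (x m)

theorem entire_step {Nin Nr : ℕ} {U : Set (Vec Nin)} {X : Set (Vec Nr)}
    (g : U → X → X) (u : ℤ → U) (x : ℤ → X) (h : entire g u x) (n : ℤ) :
    x n = g (u n) (x (n - 1)) := by
  have h1 := h (n - 1) n (by omega)
  have e : (n - (n - 1)).toNat = 0 + 1 := by omega
  rw [e] at h1
  simp only [coc] at h1
  have e2 : ((0 : ℕ) : ℤ) + 1 + (n - 1) = n := by push_cast; ring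
  rw [e2] at h1
  exact h1

theorem entire_of_step {Nin Nr : ℕ} {U : Set (Vec Nin)} {X : Set (Vec Nr)}
    (g : U → X → X) (u : ℤ → U) (x : ℤ → X)
    (h : ∀ n, x n = g (u n) (x (n - 1))) : entire g u x := by
  have key : ∀ (m : ℤ) (k : ℕ), x (m + k) = coc g k (fun j => u (j + m)) (x m) := by
    intro m k
    induction k with
    | zero => simp [coc]
    | succ k ih =>
      simp only [coc]
      rw [← ih, h (m + ((k + 1 : ℕ) : ℤ))]
      have e1 : m + ((k + 1 : ℕ) : ℤ) - 1 = m + k := by push_cast; ring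
      have e2 : m + ((k + 1 : ℕ) : ℤ) = (k : ℤ) + 1 + m := by push_cast; ring
      rw [e1, e2]
  intro m n hmn
  have := key m (n - m).toNat
  rw [← this]
  congr 1
  omega

/-- If `g` is continuous and a uniform `μ`-contraction in the state
variable (`0 < μ < 1`) and `H` is the (unique) continuous map satisfying
`H(u) = g(u[1], H(θ⁻¹ u))` for all `u ∈ 𝒰 = U^ℤ`, then the echo state property holds:
every entire solution `x` for `u` satisfies `x[n] = H(θ^{n−1} u)`; in particular every
`u` has exactly one entire solution. -/
theorem stmt4 (Nin Nr : ℕ) (U : Set (Vec Nin)) (X : Set (Vec Nr))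
    (hU : IsCompact U) (hX : IsCompact X)
    (g : U → X → X) (hg : Continuous fun p : U × X => g p.1 p.2)
    (μ : ℝ) (hμ0 : 0 < μ) (hμ1 : μ < 1)
    (hcontr : ∀ (u : U) (x z : X),
      ‖(g u x : Vec Nr) - (g u z : Vec Nr)‖ ≤ μ * ‖(x : Vec Nr) - (z : Vec Nr)‖)
    (H : (ℤ → U) → X) (hHcont : Continuous H)
    (hHfix : ∀ u : ℤ → U, H u = g (u 1) (H fun k => u (k - 1))) :
    (∀ (u : ℤ → U) (x : ℤ → X), entire g u x →
      ∀ n : ℤ, x n = H fun k => u (k + (n - 1))) ∧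
    (∀ u : ℤ → U, ∃! x : ℤ → X, entire g u x) := by
  have hHe : ∀ u : ℤ → U, entire g u (fun n => H fun k => u (k + (n - 1))) := by
    intro u
    apply entire_of_step
    intro n
    rw [hHfix]
    have e1 : (1 : ℤ) + (n - 1) = n := by ring
    have e2 : (fun k : ℤ => u (k - 1 + (n - 1))) = fun k => u (k + (n - 1 - 1)) := by
      funext k
      congr 1
      ring
    rw [e1, e2]
  obtain ⟨C, hC⟩ := hX.isBounded.exists_norm_le
  have huniq : ∀ (u : ℤ → U) (x y : ℤ → X), entire g u x → entire g u y → ∀ n, x n = y n := by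
    intro u x y hx hy n
    have hb : ∀ (k : ℕ) (n : ℤ), ‖(x n : Vec Nr) - (y n : Vec Nr)‖ ≤ μ ^ k * (C + C) := by
      intro k
      induction k with
      | zero =>
        intro n
        rw [pow_zero, one_mul]
        exact (norm_sub_le _ _).trans (add_le_add (hC _ (x n).2) (hC _ (y n).2))
      | succ k ih =>
        intro n
        rw [entire_step g u x hx n, entire_step g u y hy n]
        refine (hcontr _ _ _).trans ?_
        rw [pow_succ', mul_assoc]
        exact mul_le_mul_of_nonneg_left (ih _) hμ0.le
    have ht : Tendsto (fun k : ℕ => μ ^ k * (C + C)) atTop (𝓝 (0 * (C + C))) :=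
      (tendsto_pow_atTop_nhds_zero_of_lt_one hμ0.le hμ1).mul_const _
    rw [zero_mul] at ht
    have h0 := ge_of_tendsto' ht (fun k => hb k n)
    exact Subtype.ext (sub_eq_zero.mp (norm_le_zero_iff.mp h0))
  refine ⟨fun u x hx n => huniq u x _ hx (hHe u) n, fun u => ⟨_, hHe u, fun y hy => ?_⟩⟩
  funext n
  exact huniq u y _ hy (hHe u) n
end
end

section
/- Suppose g extends to a continuously differentiable map on an open neighbourhood of U × X in ℝ^{N_in} × ℝ^{N_r}, with g(U × X) ⊆ X. For n ∈ ℕ define F: U^n × X → X by F(ū, x) = g(ū_n, g(ū_{n−1}, …, g(ū_1, x) … )) for ū = (ū_1, …, ū_n) ∈ U^n. Then F is continuously differentiable, and F is uniformly quasidifferentiable in the state variable: for every ε > 0 there exists δ > 0 such that for all ū ∈ U^n and all x, z ∈ X with 0 < ‖x − z‖ ≤ δ, ‖F(ū, x) − F(ū, z) − D₂F(ū, x)(x − z)‖ ≤ ε‖x − z‖, where D₂F(ū, x) denotes the partial (Fréchet) derivative of F with respect to the state variable x. -/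
open Filter Topology

noncomputable section

/-- The `n`-fold iteration map `F(ub, x) = g(ub₁, g(ub₂, …, g(ub_n, x)…))`
(with `ub 0 = ub₁` the outermost input). -/
def iterF {Nin Nr : ℕ} (g : Vec Nin × Vec Nr → Vec Nr) :
    (n : ℕ) → (Fin n → Vec Nin) → Vec Nr → Vec Nr
  | 0, _, x => x
  | n + 1, u, x => g (u 0, iterF g n (fun i => u i.succ) x)

theorem unif_quasi {E F : Type*} [NormedAddCommGroup E] [NormedSpace ℝ E]
    [NormedAddCommGroup F] [NormedSpace ℝ F] (f : E → F) (K : Set E) (hK : IsCompact K)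
    (hf : ∀ p ∈ K, ContDiffAt ℝ 1 f p) (ε : ℝ) (hε : 0 < ε) :
    ∃ δ > (0 : ℝ), ∀ a ∈ K, ∀ b, dist b a < δ →
      ‖f a - f b - fderiv ℝ f a (a - b)‖ ≤ ε * ‖a - b‖ := by
  have key : ∀ p : K, ∃ V : Set E, IsOpen V ∧ (p : E) ∈ V ∧ ∀ a ∈ V, ∀ b ∈ V,
      ‖f a - f b - fderiv ℝ f a (a - b)‖ ≤ ε * ‖a - b‖ := by
    rintro ⟨p, hp⟩
    have h1 := (hf p hp).hasStrictFDerivAt (by norm_num)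
    have h2 := (HasStrictFDerivAt.isLittleO h1).def (half_pos hε)
    rw [nhds_prod_eq] at h2
    have h3 : ∀ᶠ a in 𝓝 p, ‖fderiv ℝ f a - fderiv ℝ f p‖ < ε / 2 := by
      have hc : ContinuousAt (fderiv ℝ f) p := 
        ((hf p hp).fderiv_right (m := 0) (by norm_num)).continuousAt
      have := Metric.continuousAt_iff'.1 hc (ε / 2) (half_pos hε)
      simpa [dist_eq_norm] using this
    obtain ⟨t, ht, h4⟩ := Filter.eventually_prod_self_iff'.1 h2
    obtain ⟨V, hV, hVo, hpV⟩ := mem_nhds_iff.1 (Filter.inter_mem ht h3)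
    refine ⟨V, hVo, hpV, fun a ha b hb => ?_⟩
    have e1 := h4 a (hV ha).1 b (hV hb).1
    have e2 : ‖fderiv ℝ f a - fderiv ℝ f p‖ < ε / 2 := (hV ha).2
    have e3 := (fderiv ℝ f a - fderiv ℝ f p).le_of_opNorm_le e2.le (a - b)
    have e4 : f a - f b - fderiv ℝ f a (a - b) = (f a - f b - fderiv ℝ f p (a - b))
        - (fderiv ℝ f a - fderiv ℝ f p) (a - b) := by
      simp only [ContinuousLinearMap.sub_apply]; abel
    rw [e4]
    refine (norm_sub_le _ _).trans ?_
    simp only at e1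
    linarith
  choose V hVo hpV hV using key
  obtain ⟨δ, hδ, h⟩ := lebesgue_number_lemma_of_metric hK hVo
    (fun p hp => Set.mem_iUnion.2 ⟨⟨p, hp⟩, hpV _⟩)
  refine ⟨δ, hδ, fun a ha b hb => ?_⟩
  obtain ⟨i, hi⟩ := h a ha
  exact hV i a (hi (Metric.mem_ball_self hδ)) b (hi hb)

theorem iterF_contDiffAt {Nin Nr : ℕ} (U : Set (Vec Nin)) (X : Set (Vec Nr))
    (g : Vec Nin × Vec Nr → Vec Nr) (hg : ∀ p ∈ U ×ˢ X, ContDiffAt ℝ 1 g p)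
    (hmaps : Set.MapsTo g (U ×ˢ X) X) (n : ℕ) :
    ∀ p : (Fin n → Vec Nin) × Vec Nr, (∀ i, p.1 i ∈ U) → p.2 ∈ X →
      iterF g n p.1 p.2 ∈ X ∧
      ContDiffAt ℝ 1 (fun p : (Fin n → Vec Nin) × Vec Nr => iterF g n p.1 p.2) p := by
  induction n with
  | zero => exact fun p _ hx => ⟨hx, contDiffAt_snd⟩
  | succ n ih =>
    intro p hu hx
    obtain ⟨h1, h2⟩ := ih (fun i => p.1 i.succ, p.2) (fun i => hu _) hx
    refine ⟨hmaps ⟨hu 0, h1⟩, ?_⟩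
    have c0 : ContDiffAt ℝ 1 (fun p : (Fin (n + 1) → Vec Nin) × Vec Nr => p.1 0) p := by
      fun_prop
    have c1 : ContDiffAt ℝ 1 (fun p : (Fin (n + 1) → Vec Nin) × Vec Nr =>
        ((fun i : Fin n => p.1 i.succ, p.2) : (Fin n → Vec Nin) × Vec Nr)) p := by
      fun_prop
    have c2 := ContDiffAt.comp p h2 c1
    exact ContDiffAt.comp p (hg (p.1 0, iterF g n (fun i => p.1 i.succ) p.2) ⟨hu 0, h1⟩)
      (c0.prodMk c2)

/-- Suppose `g` is `C¹` on an open neighbourhood `O` of `U × X` with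
`g(U × X) ⊆ X`.  Then the iteration map `F(ub, x) = g(ub₁, g(ub₂, …, g(ub_n, x)…))` is
continuously differentiable (on an open neighbourhood of `U^n × X`), and `F` is uniformly
quasidifferentiable in the state variable: for every `ε > 0` there is `δ > 0` such that
for all `ub ∈ U^n` and `x, z ∈ X` with `0 < ‖x − z‖ ≤ δ`,
`‖F(ub,x) − F(ub,z) − D₂F(ub,x)(x − z)‖ ≤ ε‖x − z‖`, where `D₂F(ub,x)` is the partial
Fréchet derivative of `F` in the state variable. -/
theorem stmt6 (Nin Nr n : ℕ) (U : Set (Vec Nin)) (X : Set (Vec Nr))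
    (hU : IsCompact U) (hX : IsCompact X)
    (g : Vec Nin × Vec Nr → Vec Nr) (O : Set (Vec Nin × Vec Nr))
    (hO : IsOpen O) (hUXO : U ×ˢ X ⊆ O) (hg : ContDiffOn ℝ 1 g O)
    (hmaps : Set.MapsTo g (U ×ˢ X) X) :
    (∃ O' : Set ((Fin n → Vec Nin) × Vec Nr), IsOpen O' ∧
      (Set.univ.pi fun _ : Fin n => U) ×ˢ X ⊆ O' ∧
      ContDiffOn ℝ 1 (fun p : (Fin n → Vec Nin) × Vec Nr => iterF g n p.1 p.2) O') ∧
    (∀ ε > (0 : ℝ), ∃ δ > (0 : ℝ), ∀ ub : Fin n → Vec Nin, (∀ i, ub i ∈ U) →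
      ∀ x ∈ X, ∀ z ∈ X, 0 < ‖x - z‖ → ‖x - z‖ ≤ δ →
        ‖iterF g n ub x - iterF g n ub z - fderiv ℝ (iterF g n ub) x (x - z)‖ ≤
          ε * ‖x - z‖) := by
  have hg' : ∀ p ∈ U ×ˢ X, ContDiffAt ℝ 1 g p := fun p hp =>
    hg.contDiffAt (hO.mem_nhds (hUXO hp))
  have hF := iterF_contDiffAt U X g hg' hmaps n
  have hF' : ∀ p ∈ (Set.univ.pi fun _ : Fin n => U) ×ˢ X,
      ContDiffAt ℝ 1 (fun p : (Fin n → Vec Nin) × Vec Nr => iterF g n p.1 p.2) p :=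
    fun p hp => (hF p (fun i => hp.1 i trivial) hp.2).2
  refine ⟨⟨{p | ContDiffAt ℝ 1 (fun p : (Fin n → Vec Nin) × Vec Nr => iterF g n p.1 p.2) p},
    ?_, hF', fun p hp => ContDiffAt.contDiffWithinAt hp⟩, ?_⟩
  · exact isOpen_iff_mem_nhds.2 fun p hp => ContDiffAt.eventually hp (by simp)
  · intro ε hε
    obtain ⟨δ, hδ, h⟩ := unif_quasi _ _ ((isCompact_univ_pi fun _ => hU).prod hX) hF' ε hε
    refine ⟨δ / 2, half_pos hδ, fun ub hub x hx z hz _ hxz => ?_⟩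
    have hm : (ub, x) ∈ (Set.univ.pi fun _ : Fin n => U) ×ˢ X := ⟨fun i _ => hub i, hx⟩
    have hd : dist (ub, z) (ub, x) < δ := by
      rw [Prod.dist_eq, dist_self, dist_comm z x, dist_eq_norm]
      exact max_lt hδ (by linarith)
    have h1 := h _ hm (ub, z) hd
    have h2 := HasFDerivAt.comp x ((hF' _ hm).differentiableAt (by norm_num)).hasFDerivAt
        (hasFDerivAt_prodMk_right ub x)
    have h4 : fderiv ℝ (iterF g n ub) x = _ := h2.fderiv
    rw [h4]
    have h3 : ‖((ub, x) : (Fin n → Vec Nin) × Vec Nr) - (ub, z)‖ = ‖x - z‖ := by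
      simp [Prod.norm_def]
    rw [h3] at h1
    simpa using h1
end
end

section
/- Let φ: U → U be a bijection such that for some constant C > 1, ‖φ(u) − φ(v)‖ ≤ C‖u − v‖ and ‖φ⁻¹(u) − φ⁻¹(v)‖ ≤ C‖u − v‖ for all u, v ∈ U. Choose the weighting sequence w_n = C^{−n}. Then the trajectory map Ψ: U → 𝒰 defined by Ψ(u)[n] = φ^n(u) for n ∈ ℤ (with φ^{−n} = (φ⁻¹)^n for n > 0) satisfies ‖u − v‖ ≤ d^w(Ψ(u), Ψ(v)) ≤ ‖u − v‖ for all u, v ∈ U, i.e. Ψ is an isometry of U onto its image 𝒱_{(U,φ)} = Ψ(U) ⊆ 𝒰; consequently dim_B 𝒱_{(U,φ)} = dim_B U. -/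
open Filter Topology
open scoped ENNReal

noncomputable section

/-- The weighted sup metric `d^w(u, v) = sup_{n ∈ ℤ} w_{|n|} ‖u[n] − v[n]‖` on `𝒰 = U^ℤ`. -/
def dw {Nin : ℕ} {U : Set (Vec Nin)} (w : ℕ → ℝ) (u v : ℤ → U) : ℝ :=
  ⨆ n : ℤ, w n.natAbs * ‖(u n : Vec Nin) - (v n : Vec Nin)‖

/-- `N(s, ε)`: the minimal number of balls of radius `ε` (for the distance `d`) with
centres in `s` needed to cover `s`. -/
def coverN {α : Type*} (d : α → α → ℝ) (s : Set α) (ε : ℝ) : ℕ :=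
  sInf {k : ℕ | ∃ t : Finset α, ↑t ⊆ s ∧ (∀ x ∈ s, ∃ c ∈ t, d c x < ε) ∧ t.card = k}

/-- The upper box-counting dimension `dim_B s = limsup_{ε→0⁺} log N(s,ε) / (−log ε)`,
valued in `ℝ≥0∞`. -/
def dimB {α : Type*} (d : α → α → ℝ) (s : Set α) : ℝ≥0∞ :=
  Filter.limsup (fun ε : ℝ => ENNReal.ofReal (Real.log (coverN d s ε) / (-Real.log ε)))
    (nhdsWithin 0 (Set.Ioi 0))

theorem coverN_range {α β : Type*} (d : α → α → ℝ) (f : β → α) (hf : Function.Injective f)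
    (ε : ℝ) : coverN d (Set.range f) ε = coverN (fun a b => d (f a) (f b)) Set.univ ε := by
  classical
  unfold coverN
  congr 1
  ext k
  constructor
  · rintro ⟨t, ht, hc, rfl⟩
    rw [← Set.image_univ] at ht
    obtain ⟨s, -, rfl⟩ := Finset.subset_set_image_iff.1 ht
    refine ⟨s, Set.subset_univ _, ?_, (Finset.card_image_of_injective _ hf).symm⟩
    intro x _
    obtain ⟨c, hc1, hc2⟩ := hc (f x) ⟨x, rfl⟩
    obtain ⟨b, hb, rfl⟩ := Finset.mem_image.1 hc1
    exact ⟨b, hb, hc2⟩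
  · rintro ⟨s, -, hc, rfl⟩
    refine ⟨s.image f, ?_, ?_, Finset.card_image_of_injective _ hf⟩
    · rw [Finset.coe_image]
      exact Set.image_subset_range _ _
    · rintro _ ⟨x, rfl⟩
      obtain ⟨c, hc1, hc2⟩ := hc x (Set.mem_univ _)
      exact ⟨f c, Finset.mem_image_of_mem _ hc1, hc2⟩

/-- Let `φ : U → U` be a bijection with `‖φ(u) − φ(v)‖ ≤ C‖u − v‖`
and `‖φ⁻¹(u) − φ⁻¹(v)‖ ≤ C‖u − v‖` for some `C > 1`, and take the weights
`w_n = C^{−n}`.  Then the trajectory map `Ψ(u)[n] = φ^n(u)` (for `n ∈ ℤ`) satisfies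
`‖u − v‖ ≤ d^w(Ψ u, Ψ v) ≤ ‖u − v‖`, i.e. it is an isometry of `U` onto its image
`𝒱_{(U,φ)} = Ψ(U)`; consequently `dim_B 𝒱_{(U,φ)} = dim_B U`. -/
theorem stmt9 (Nin : ℕ) (U : Set (Vec Nin)) (hU : IsCompact U)
    (φ φinv : U → U)
    (hbij : Function.LeftInverse φinv φ ∧ Function.RightInverse φinv φ)
    (C : ℝ) (hC : 1 < C)
    (hlip : ∀ u v : U, ‖(φ u : Vec Nin) - (φ v : Vec Nin)‖ ≤ C * ‖(u : Vec Nin) - (v : Vec Nin)‖)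
    (hlipinv : ∀ u v : U,
      ‖(φinv u : Vec Nin) - (φinv v : Vec Nin)‖ ≤ C * ‖(u : Vec Nin) - (v : Vec Nin)‖)
    (w : ℕ → ℝ) (hw : ∀ n : ℕ, w n = C ^ (-(n : ℤ)))
    -- `Ψ u` is the full trajectory of `u` under `φ`: `Ψ(u)[n] = φ^n(u)` for `n ∈ ℤ`
    (Ψ : U → (ℤ → U)) (hΨ0 : ∀ u, Ψ u 0 = u) (hΨs : ∀ u n, Ψ u (n + 1) = φ (Ψ u n)) :
    (∀ u v : U,
      ‖(u : Vec Nin) - (v : Vec Nin)‖ ≤ dw w (Ψ u) (Ψ v) ∧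
      dw w (Ψ u) (Ψ v) ≤ ‖(u : Vec Nin) - (v : Vec Nin)‖) ∧
    dimB (dw w) (Set.range Ψ) = dimB (fun a b : Vec Nin => dist a b) U := by
  have hC0 : (0 : ℝ) < C := by linarith
  have hpred : ∀ u n, Ψ u (n - 1) = φinv (Ψ u n) := by
    intro u n
    have h := hΨs u (n - 1)
    rw [sub_add_cancel] at h
    rw [h, hbij.1]
  have hpos : ∀ (u v : U) (n : ℕ), ‖(Ψ u n : Vec Nin) - (Ψ v n : Vec Nin)‖ ≤
      C ^ n * ‖(u : Vec Nin) - (v : Vec Nin)‖ := by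
    intro u v n
    induction n with
    | zero => simp [hΨ0]
    | succ k ih =>
      push_cast
      rw [hΨs, hΨs, pow_succ', mul_assoc]
      exact (hlip _ _).trans (mul_le_mul_of_nonneg_left ih hC0.le)
  have hneg : ∀ (u v : U) (n : ℕ), ‖(Ψ u (-(n : ℤ)) : Vec Nin) - (Ψ v (-(n : ℤ)) : Vec Nin)‖ ≤
      C ^ n * ‖(u : Vec Nin) - (v : Vec Nin)‖ := by
    intro u v n
    induction n with
    | zero => simp [hΨ0]
    | succ k ih =>
      have e : (-((k + 1 : ℕ) : ℤ)) = -(k : ℤ) - 1 := by push_cast; ring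
      rw [e, hpred, hpred, pow_succ', mul_assoc]
      exact (hlipinv _ _).trans (mul_le_mul_of_nonneg_left ih hC0.le)
  have hterm : ∀ (u v : U) (n : ℤ), w n.natAbs * ‖(Ψ u n : Vec Nin) - (Ψ v n : Vec Nin)‖ ≤
      ‖(u : Vec Nin) - (v : Vec Nin)‖ := by
    intro u v n
    have hb : ‖(Ψ u n : Vec Nin) - (Ψ v n : Vec Nin)‖ ≤
        C ^ n.natAbs * ‖(u : Vec Nin) - (v : Vec Nin)‖ := by
      rcases Int.natAbs_eq n with h | h
      · have := hpos u v n.natAbs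
        rwa [← h] at this
      · have := hneg u v n.natAbs
        rwa [← h] at this
    rw [hw, zpow_neg, zpow_natCast, inv_mul_le_iff₀ (pow_pos hC0 _)]
    exact hb
  have key : ∀ u v : U,
      ‖(u : Vec Nin) - (v : Vec Nin)‖ ≤ dw w (Ψ u) (Ψ v) ∧
      dw w (Ψ u) (Ψ v) ≤ ‖(u : Vec Nin) - (v : Vec Nin)‖ := by
    intro u v
    refine ⟨?_, ciSup_le (hterm u v)⟩
    have h := le_ciSup (f := fun n : ℤ => w n.natAbs * ‖(Ψ u n : Vec Nin) - (Ψ v n : Vec Nin)‖)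
      ⟨_, Set.forall_mem_range.2 (hterm u v)⟩ 0
    refine le_trans (le_of_eq ?_) h
    simp [hΨ0, hw]
  refine ⟨key, ?_⟩
  have hinj : Function.Injective Ψ := fun u v h => by
    rw [← hΨ0 u, ← hΨ0 v, h]
  have hcov : ∀ ε, coverN (dw w) (Set.range Ψ) ε = coverN (fun a b : Vec Nin => dist a b) U ε := by
    intro ε
    have h2 := coverN_range (fun a b : Vec Nin => dist a b) (Subtype.val : U → Vec Nin)
      Subtype.val_injective ε
    rw [Subtype.range_coe] at h2
    rw [coverN_range _ Ψ hinj, h2]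
    congr 1
    funext a b
    rw [dist_eq_norm]
    exact le_antisymm (key a b).2 (key a b).1
  unfold dimB
  simp only [hcov]
end
end
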